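/- Let U_λ be symmetric positive definite, W an arbitrary real matrix of compatible size, and V_0 symmetric positive semidefinite with pseudo-inverse V_0^†. If the generalized Schur complement S = U_λ − W V_0^† W^⊤ is positive definite, then every eigenvalue μ of U_λ^{-1} W V_0^† W^⊤ satisfies 0 ≤ μ < 1. -/

import Mathlib

open Matrix

open scoped ComplexOrder MatrixOrder in
theorem aux_psd {n : ℕ} {A : Matrix (Fin n) (Fin n) ℝ} (h : A.PosSemidef) :
    (A.map (algebraMap ℝ ℂ)).PosSemidef := by
  obtain ⟨B, rfl⟩ := CStarAlgebra.nonneg_iff_eq_star_mul_self.mp h.nonneg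
  rw [Matrix.star_eq_conjTranspose]
  have : (Bᴴ * B).map (algebraMap ℝ ℂ)
      = (B.map (algebraMap ℝ ℂ))ᴴ * B.map (algebraMap ℝ ℂ) := by
    rw [Matrix.map_mul]
    congr 1
    ext i j
    simp
  rw [this]
  exact Matrix.posSemidef_conjTranspose_mul_self _

open scoped ComplexOrder in
theorem aux_pd {n : ℕ} {A : Matrix (Fin n) (Fin n) ℝ} (h : A.PosDef) :
    (A.map (algebraMap ℝ ℂ)).PosDef := by
  rw [(aux_psd h.posSemidef).posDef_iff_isUnit]
  exact h.isUnit.map (algebraMap ℝ ℂ).mapMatrix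

theorem aux_pinv {n : ℕ} {A B : Matrix (Fin n) (Fin n) ℝ} (hA : A.PosSemidef)
    (h1 : A * B * A = A) (h2 : B * A * B = B)
    (h3 : (A * B)ᵀ = A * B) (h4 : (B * A)ᵀ = B * A) : B.PosSemidef := by
  have hs : Aᵀ = A := by simpa using hA.isHermitian.eq
  have e1 : A * Bᵀ * A = A := by
    have := congrArg Matrix.transpose h1
    simpa [Matrix.transpose_mul, hs, Matrix.mul_assoc] using this
  have e2 : Bᵀ * A * Bᵀ = Bᵀ := by
    have := congrArg Matrix.transpose h2
    simpa [Matrix.transpose_mul, hs, Matrix.mul_assoc] using this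
  have e3 : Bᵀ * A = A * B := by simpa [Matrix.transpose_mul, hs] using h3
  have e4 : A * Bᵀ = B * A := by simpa [Matrix.transpose_mul, hs] using h4
  have e5 : A * B = B * A := by
    have a1 : (B * A) * (A * B) = A * B := by
      rw [← e4, ← Matrix.mul_assoc, e1]
    have a2 := congrArg Matrix.transpose a1
    rw [Matrix.transpose_mul, h3, h4, ← e4, ← Matrix.mul_assoc, h1, e4] at a2
    exact a2.symm
  have e6 : Bᵀ = B := by
    calc Bᵀ = Bᵀ * A * Bᵀ := e2.symm
      _ = B * A * Bᵀ := by rw [e3, e5]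
      _ = B * A * B := by rw [Matrix.mul_assoc, e4.trans e5.symm, Matrix.mul_assoc]
      _ = B := h2
  have h := hA.conjTranspose_mul_mul_same B
  rwa [Matrix.conjTranspose_eq_transpose_of_trivial, e6, h2] at h

/-- Lemma 1 of the paper: if `Ul` is symmetric positive definite, `V₀` is
symmetric positive semidefinite with Moore–Penrose pseudo-inverse `Vd`,
and the generalized Schur complement `S = Ul - W * Vd * Wᵀ` is positive
definite, then every eigenvalue `μ` of `Ul⁻¹ * W * Vd * Wᵀ` satisfies
`0 ≤ μ < 1`. -/
theorem eigenvalues_varpro_schur {np nl : ℕ}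
    (Ul : Matrix (Fin np) (Fin np) ℝ) (W : Matrix (Fin np) (Fin nl) ℝ)
    (V₀ Vd : Matrix (Fin nl) (Fin nl) ℝ)
    (hU : Ul.PosDef) (hV : V₀.PosSemidef)
    -- the four Moore–Penrose conditions for `Vd = V₀†`
    (h1 : V₀ * Vd * V₀ = V₀) (h2 : Vd * V₀ * Vd = Vd)
    (h3 : (V₀ * Vd)ᵀ = V₀ * Vd) (h4 : (Vd * V₀)ᵀ = Vd * V₀)
    (hS : (Ul - W * Vd * Wᵀ).PosDef) :
    ∀ μ ∈ spectrum ℂ ((Ul⁻¹ * (W * Vd * Wᵀ)).map (algebraMap ℝ ℂ)),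
      ∃ r : ℝ, 0 ≤ r ∧ r < 1 ∧ μ = (r : ℂ) := by
  classical
  open scoped ComplexOrder in
  intro μ hμ
  have hVd := aux_pinv hV h1 h2 h3 h4
  have hM : (W * Vd * Wᵀ).PosSemidef := by
    have := hVd.mul_mul_conjTranspose_same W
    rwa [Matrix.conjTranspose_eq_transpose_of_trivial] at this
  generalize W * Vd * Wᵀ = M at *
  have hMc := aux_psd hM
  have hUc := aux_pd hU
  have hSc := aux_pd hS
  rw [← Matrix.spectrum_toLin', ← Module.End.hasEigenvalue_iff_mem_spectrum] at hμ
  obtain ⟨v, hv⟩ := hμ.exists_hasEigenvector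
  have hv0 := hv.2
  have hv1 := hv.apply_eq_smul
  rw [Matrix.toLin'_apply] at hv1
  have hUM : Ul * (Ul⁻¹ * M) = M := by
    rw [← Matrix.mul_assoc, Matrix.mul_nonsing_inv _ ((Matrix.isUnit_iff_isUnit_det _).mp hU.isUnit),
      Matrix.one_mul]
  have key : M.map (algebraMap ℝ ℂ) *ᵥ v = μ • (Ul.map (algebraMap ℝ ℂ) *ᵥ v) := by
    rw [← Matrix.mulVec_smul, ← hv1, Matrix.mulVec_mulVec, ← Matrix.map_mul, hUM]
  have qM := hMc.dotProduct_mulVec_nonneg v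
  have qU := hUc.dotProduct_mulVec_pos hv0
  have qS := hSc.dotProduct_mulVec_pos hv0
  rw [Matrix.map_sub _ (by intros; simp), Matrix.sub_mulVec, dotProduct_sub] at qS
  rw [key, dotProduct_smul, smul_eq_mul] at qM qS
  generalize star v ⬝ᵥ (Ul.map (algebraMap ℝ ℂ) *ᵥ v) = q at *
  rw [Complex.lt_def] at qU qS
  rw [Complex.le_def] at qM
  simp at qU qS qM
  obtain ⟨hq, hq'⟩ := qU
  rw [← hq'] at qM qS
  simp at qM qS
  have him : μ.im = 0 := by
    rcases qM.2 with h | h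
    · exact h
    · exact absurd h hq.ne'
  refine ⟨μ.re, ?_, ?_, Complex.ext (by simp) (by simp [him])⟩
  · exact nonneg_of_mul_nonneg_left qM.1 hq
  · nlinarith [qS.1]
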